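/- arXiv:2304.03814 — 3 statements merged into one kernel-verified Lean document; each statement's English description precedes it below -/
import Mathlib

section
/- Any orean factorization (F_s, F_e) of a category C is a semiexact pair: the assignment α(A) = Im^e(ι^s_A), sending an F_s-cluster A to the F_e-image of an F_s-embedding of A, is well defined (independent of the choice of embedding) and is a conormal operator F_s → F_e; dually, β(R) = Ker^s(π^e_R) is a well-defined normal operator F_e → F_s. -/
open CategoryTheory

universe w v u

/-- A form over a category `C`, presented as a cluster system:
clusters per object and relations `B ≥_f A` (written `Rel f A B`),
satisfying (F1)-(F3). -/
structure Form (C : Type u) [Category.{v} C] where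
  Cl : C → Type w
  Rel : ∀ {X Y : C}, (X ⟶ Y) → Cl X → Cl Y → Prop
  rel_id : ∀ {X : C} (A : Cl X), Rel (𝟙 X) A A
  rel_comp : ∀ {X Y Z : C} {f : X ⟶ Y} {g : Y ⟶ Z} {A : Cl X} {B : Cl Y} {D : Cl Z},
      Rel f A B → Rel g B D → Rel (f ≫ g) A D
  rel_antisymm : ∀ {X : C} {A B : Cl X}, Rel (𝟙 X) A B → Rel (𝟙 X) B A → A = B

namespace Form

variable {C : Type u} [Category.{v} C]

/-- The fibre order on clusters. -/
def le (F : Form C) {X : C} (A B : F.Cl X) : Prop := F.Rel (𝟙 X) A B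

/-- `S` is the image of `f`, i.e. the direct image of the top cluster of the
domain of `f` along `f`. -/
def IsImageOf (F : Form C) {W X : C} (S : F.Cl X) (f : W ⟶ X) : Prop :=
  ∃ t : F.Cl W, (∀ A : F.Cl W, F.le A t) ∧ F.Rel f t S ∧ ∀ T : F.Cl X, F.Rel f t T → F.le S T

/-- `S` is the kernel of `g`, i.e. the inverse image of the bottom cluster of the
codomain of `g` along `g`. -/
def IsKernelOf (F : Form C) {X Y : C} (S : F.Cl X) (g : X ⟶ Y) : Prop :=
  ∃ b : F.Cl Y, (∀ A : F.Cl Y, F.le b A) ∧ F.Rel g S b ∧ ∀ T : F.Cl X, F.Rel g T b → F.le T S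

/-- A cluster is conormal when it is an image of some morphism. -/
def ConormalCl (F : Form C) {X : C} (S : F.Cl X) : Prop :=
  ∃ (W : C) (f : W ⟶ X), F.IsImageOf S f

/-- A cluster is normal when it is a kernel of some morphism. -/
def NormalCl (F : Form C) {X : C} (S : F.Cl X) : Prop :=
  ∃ (Y : C) (g : X ⟶ Y), F.IsKernelOf S g

/-- A form is conormal when every cluster is conormal. -/
def IsConormal (F : Form C) : Prop := ∀ (X : C) (S : F.Cl X), F.ConormalCl S

/-- A form is normal when every cluster is normal. -/
def IsNormal (F : Form C) : Prop := ∀ (X : C) (S : F.Cl X), F.NormalCl S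

def IsJoinOf (F : Form C) {X : C} (A B J : F.Cl X) : Prop :=
  F.le A J ∧ F.le B J ∧ ∀ D : F.Cl X, F.le A D → F.le B D → F.le J D

def IsMeetOf (F : Form C) {X : C} (A B M : F.Cl X) : Prop :=
  F.le M A ∧ F.le M B ∧ ∀ D : F.Cl X, F.le D A → F.le D B → F.le D M

/-- `T` is the direct image of `S` along `f`. -/
def IsDimgOf (F : Form C) {X Y : C} (f : X ⟶ Y) (S : F.Cl X) (T : F.Cl Y) : Prop :=
  F.Rel f S T ∧ ∀ T' : F.Cl Y, F.Rel f S T' → F.le T T'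

/-- `S` is the inverse image of `T` along `f`. -/
def IsIimgOf (F : Form C) {X Y : C} (f : X ⟶ Y) (T : F.Cl Y) (S : F.Cl X) : Prop :=
  F.Rel f S T ∧ ∀ S' : F.Cl X, F.Rel f S' T → F.le S' S

/-- Orean form: (O1) fibres are bounded lattices, (O3) direct and inverse images exist,
(O2) relations along composites decompose. -/
def IsOrean (F : Form C) : Prop :=
  (∀ X : C, ∃ b : F.Cl X, ∀ A, F.le b A) ∧
  (∀ X : C, ∃ t : F.Cl X, ∀ A, F.le A t) ∧
  (∀ (X : C) (A B : F.Cl X), ∃ J, F.IsJoinOf A B J) ∧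
  (∀ (X : C) (A B : F.Cl X), ∃ M, F.IsMeetOf A B M) ∧
  (∀ {X Y : C} (f : X ⟶ Y) (S : F.Cl X), ∃ T, F.IsDimgOf f S T) ∧
  (∀ {X Y : C} (f : X ⟶ Y) (T : F.Cl Y), ∃ S, F.IsIimgOf f T S) ∧
  (∀ {X Y Z : C} (f : X ⟶ Y) (g : Y ⟶ Z) (A : F.Cl X) (D : F.Cl Z),
      F.Rel (f ≫ g) A D → ∃ B : F.Cl Y, F.Rel f A B ∧ F.Rel g B D)

/-- `m` is an embedding of the (conormal) cluster `S`. -/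
def IsEmbeddingOf (F : Form C) {W X : C} (m : W ⟶ X) (S : F.Cl X) : Prop :=
  F.IsImageOf S m ∧ ∀ {W' : C} (f' : W' ⟶ X) (S' : F.Cl X),
    F.IsImageOf S' f' → F.le S' S → ∃! g : W' ⟶ W, g ≫ m = f'

/-- `e` is a quotient of the (normal) cluster `K`. -/
def IsQuotientOf (F : Form C) {X Y : C} (e : X ⟶ Y) (K : F.Cl X) : Prop :=
  F.IsKernelOf K e ∧ ∀ {Y' : C} (g' : X ⟶ Y') (K' : F.Cl X),
    F.IsKernelOf K' g' → F.le K K' → ∃! h : Y ⟶ Y', e ≫ h = g'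

/-- The axiom (N1) for a general form, stated via characterizing predicates. -/
def N1 (F : Form C) : Prop :=
  (∀ {X Y : C} (f : X ⟶ Y) (S V : F.Cl X) (T : F.Cl Y) (K J : F.Cl X),
      F.IsDimgOf f S T → F.IsIimgOf f T V → F.IsKernelOf K f → F.IsJoinOf S K J → V = J) ∧
  (∀ {X Y : C} (f : X ⟶ Y) (T : F.Cl Y) (S : F.Cl X) (U I M : F.Cl Y),
      F.IsIimgOf f T S → F.IsDimgOf f S U → F.IsImageOf I f → F.IsMeetOf T I M → U = M)

/-- The axiom (N2) for a general form. -/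
def N2 (F : Form C) : Prop :=
  ∀ {X Y : C} (f : X ⟶ Y), ∃ (I : C) (e : X ⟶ I) (m : I ⟶ Y) (K : F.Cl X) (S : F.Cl Y),
    F.IsKernelOf K f ∧ F.IsQuotientOf e K ∧ F.IsImageOf S f ∧ F.IsEmbeddingOf m S ∧ e ≫ m = f

/-- The axiom (N3) for a general form. -/
def N3 (F : Form C) : Prop :=
  (∀ {X : C} (S T J : F.Cl X), F.NormalCl S → F.NormalCl T → F.IsJoinOf S T J → F.NormalCl J) ∧
  (∀ {X : C} (S T M : F.Cl X), F.ConormalCl S → F.ConormalCl T → F.IsMeetOf S T M → F.ConormalCl M)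

/-- The subform of `F` given by a selection of clusters. -/
def Subform (F : Form C) (P : ∀ X : C, F.Cl X → Prop) : Form C where
  Cl X := {A : F.Cl X // P X A}
  Rel f A B := F.Rel f A.1 B.1
  rel_id A := F.rel_id A.1
  rel_comp h h' := F.rel_comp h h'
  rel_antisymm h h' := Subtype.ext (F.rel_antisymm h h')

/-- The product of two forms over the same category. -/
def prod (F G : Form C) : Form C where
  Cl X := F.Cl X × G.Cl X
  Rel f A B := F.Rel f A.1 B.1 ∧ G.Rel f A.2 B.2
  rel_id A := ⟨F.rel_id A.1, G.rel_id A.2⟩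
  rel_comp h h' := ⟨F.rel_comp h.1 h'.1, G.rel_comp h.2 h'.2⟩
  rel_antisymm h h' := Prod.ext (F.rel_antisymm h.1 h'.1) (G.rel_antisymm h.2 h'.2)

/-- Isomorphism of forms over the same category. -/
def IsIsomorphic (F G : Form C) : Prop :=
  ∃ e : ∀ X : C, F.Cl X ≃ G.Cl X,
    ∀ {X Y : C} (f : X ⟶ Y) (A : F.Cl X) (B : F.Cl Y),
      F.Rel f A B ↔ G.Rel f (e X A) (e Y B)

/-- An orean factorization (stated for general forms): a conormal orean form together
with a normal orean form such that every morphism factors as a quotient of its kernel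
followed by an embedding of its image. -/
def IsOreanFactorization (Fs Fe : Form C) : Prop :=
  Fs.IsOrean ∧ Fs.IsConormal ∧ Fe.IsOrean ∧ Fe.IsNormal ∧
  ∀ {X Y : C} (f : X ⟶ Y), ∃ (I : C) (e : X ⟶ I) (m : I ⟶ Y) (K : Fe.Cl X) (S : Fs.Cl Y),
    Fe.IsKernelOf K f ∧ Fe.IsQuotientOf e K ∧ Fs.IsImageOf S f ∧ Fs.IsEmbeddingOf m S ∧
    e ≫ m = f

end Form

/-- An operator between two forms over the same category. -/
structure Operator {C : Type u} [Category.{v} C] (F G : Form C) where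
  app : ∀ {X : C}, F.Cl X → G.Cl X
  mono : ∀ {X Y : C} {f : X ⟶ Y} {A : F.Cl X} {B : F.Cl Y},
      F.Rel f A B → G.Rel f (app A) (app B)

namespace Operator

variable {C : Type u} [Category.{v} C] {F G : Form C}

/-- A full operator. -/
def Full (τ : Operator F G) : Prop :=
  ∀ {X Y : C} {f : X ⟶ Y} {A : F.Cl X} {B : F.Cl Y},
    G.Rel f (τ.app A) (τ.app B) → F.Rel f A B

/-- A conormal operator: it maps images of morphisms to images. -/
def Conormal (τ : Operator F G) : Prop :=
  ∀ {W X : C} (f : W ⟶ X) (S : F.Cl X), F.IsImageOf S f → G.IsImageOf (τ.app S) f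

/-- A normal operator: it maps kernels of morphisms to kernels. -/
def Normal (τ : Operator F G) : Prop :=
  ∀ {X Y : C} (g : X ⟶ Y) (S : F.Cl X), F.IsKernelOf S g → G.IsKernelOf (τ.app S) g

end Operator

/-- The identity operator. -/
def Form.idOp {C : Type u} [Category.{v} C] (F : Form C) : Operator F F :=
  ⟨fun A => A, fun h => h⟩

/-- The inclusion of a subform. -/
def Form.subformIncl {C : Type u} [Category.{v} C] (F : Form C) (P : ∀ X : C, F.Cl X → Prop) :
    Operator (F.Subform P) F where
  app A := A.1
  mono h := h

/-- The subform of clusters fixed by an operator `κ : F → F`. -/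
def Form.fixedSubform {C : Type u} [Category.{v} C] (F : Form C) (κ : Operator F F) : Form C :=
  F.Subform (fun _ A => κ.app A = A)

/-- A semiexact pair of forms. -/
def IsSemiexactPair {C : Type u} [Category.{v} C] (Fs Fe : Form C) : Prop :=
  Fs.IsOrean ∧ Fs.IsConormal ∧ Fe.IsOrean ∧ Fe.IsNormal ∧
  (∃ α : Operator Fs Fe, α.Conormal) ∧ (∃ β : Operator Fe Fs, β.Normal)

/-- A left exact pair of forms: a semiexact pair where the conormal operator is a
left inverse of the normal operator. -/
def IsLeftExactPair {C : Type u} [Category.{v} C] (Fs Fe : Form C) : Prop :=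
  Fs.IsOrean ∧ Fs.IsConormal ∧ Fe.IsOrean ∧ Fe.IsNormal ∧
  ∃ (α : Operator Fs Fe) (β : Operator Fe Fs), α.Conormal ∧ β.Normal ∧
    ∀ {X : C} (R : Fe.Cl X), α.app (β.app R) = R

/-- An orean form, with the (uniquely determined) bounded-lattice and
direct/inverse image structure bundled. -/
structure OreanForm (C : Type u) [Category.{v} C] extends Form C where
  bot : ∀ X : C, Cl X
  top : ∀ X : C, Cl X
  join : ∀ {X : C}, Cl X → Cl X → Cl X
  meet : ∀ {X : C}, Cl X → Cl X → Cl X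
  dimg : ∀ {X Y : C}, (X ⟶ Y) → Cl X → Cl Y
  iimg : ∀ {X Y : C}, (X ⟶ Y) → Cl Y → Cl X
  bot_le : ∀ {X : C} (A : Cl X), Rel (𝟙 X) (bot X) A
  le_top : ∀ {X : C} (A : Cl X), Rel (𝟙 X) A (top X)
  le_join_left : ∀ {X : C} (A B : Cl X), Rel (𝟙 X) A (join A B)
  le_join_right : ∀ {X : C} (A B : Cl X), Rel (𝟙 X) B (join A B)
  join_le : ∀ {X : C} {A B D : Cl X}, Rel (𝟙 X) A D → Rel (𝟙 X) B D → Rel (𝟙 X) (join A B) D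
  meet_le_left : ∀ {X : C} (A B : Cl X), Rel (𝟙 X) (meet A B) A
  meet_le_right : ∀ {X : C} (A B : Cl X), Rel (𝟙 X) (meet A B) B
  le_meet : ∀ {X : C} {A B D : Cl X}, Rel (𝟙 X) D A → Rel (𝟙 X) D B → Rel (𝟙 X) D (meet A B)
  rel_dimg : ∀ {X Y : C} (f : X ⟶ Y) (S : Cl X), Rel f S (dimg f S)
  dimg_le : ∀ {X Y : C} {f : X ⟶ Y} {S : Cl X} {T : Cl Y}, Rel f S T → Rel (𝟙 Y) (dimg f S) T
  iimg_rel : ∀ {X Y : C} (f : X ⟶ Y) (T : Cl Y), Rel f (iimg f T) T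
  le_iimg : ∀ {X Y : C} {f : X ⟶ Y} {S : Cl X} {T : Cl Y}, Rel f S T → Rel (𝟙 X) S (iimg f T)
  rel_decomp : ∀ {X Y Z : C} {f : X ⟶ Y} {g : Y ⟶ Z} {A : Cl X} {D : Cl Z},
      Rel (f ≫ g) A D → ∃ B : Cl Y, Rel f A B ∧ Rel g B D

namespace OreanForm

variable {C : Type u} [Category.{v} C]

def le (F : OreanForm C) {X : C} (A B : F.Cl X) : Prop := F.Rel (𝟙 X) A B

/-- The image of a morphism: direct image of the top cluster. -/
def Im (F : OreanForm C) {W X : C} (f : W ⟶ X) : F.Cl X := F.dimg f (F.top W)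

/-- The kernel of a morphism: inverse image of the bottom cluster. -/
def Ker (F : OreanForm C) {X Y : C} (g : X ⟶ Y) : F.Cl X := F.iimg g (F.bot Y)

def Conormal (F : OreanForm C) {X : C} (S : F.Cl X) : Prop :=
  ∃ (W : C) (f : W ⟶ X), F.Im f = S

def Normal (F : OreanForm C) {X : C} (S : F.Cl X) : Prop :=
  ∃ (Y : C) (g : X ⟶ Y), F.Ker g = S

def IsConormalForm (F : OreanForm C) : Prop := ∀ {X : C} (S : F.Cl X), F.Conormal S

def IsNormalForm (F : OreanForm C) : Prop := ∀ {X : C} (S : F.Cl X), F.Normal S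

def IsBinormalForm (F : OreanForm C) : Prop := F.IsConormalForm ∧ F.IsNormalForm

/-- `m` is an embedding of the cluster `S`. -/
def IsEmbedding (F : OreanForm C) {W X : C} (m : W ⟶ X) (S : F.Cl X) : Prop :=
  F.Im m = S ∧ ∀ {W' : C} (f' : W' ⟶ X), F.le (F.Im f') S → ∃! g : W' ⟶ W, g ≫ m = f'

/-- `e` is a quotient of the cluster `K`. -/
def IsQuotient (F : OreanForm C) {X Y : C} (e : X ⟶ Y) (K : F.Cl X) : Prop :=
  F.Ker e = K ∧ ∀ {Y' : C} (g' : X ⟶ Y'), F.le K (F.Ker g') → ∃! h : Y ⟶ Y', e ≫ h = g'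

/-- The axiom (N1) at a given morphism. -/
def N1At (F : OreanForm C) {X Y : C} (f : X ⟶ Y) : Prop :=
  (∀ S : F.Cl X, F.iimg f (F.dimg f S) = F.join S (F.Ker f)) ∧
  (∀ T : F.Cl Y, F.dimg f (F.iimg f T) = F.meet T (F.Im f))

def N1 (F : OreanForm C) : Prop := ∀ {X Y : C} (f : X ⟶ Y), F.N1At f

def N2 (F : OreanForm C) : Prop :=
  ∀ {X Y : C} (f : X ⟶ Y), ∃ (I : C) (e : X ⟶ I) (m : I ⟶ Y),
    F.IsQuotient e (F.Ker f) ∧ F.IsEmbedding m (F.Im f) ∧ e ≫ m = f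

def N3 (F : OreanForm C) : Prop :=
  (∀ {X : C} (S T : F.Cl X), F.Normal S → F.Normal T → F.Normal (F.join S T)) ∧
  (∀ {X : C} (S T : F.Cl X), F.Conormal S → F.Conormal T → F.Conormal (F.meet S T))

def IsNoetherian (F : OreanForm C) : Prop := F.N1 ∧ F.N2 ∧ F.N3

/-- The conormal hull: the subform of conormal clusters. -/
def conormalHull (F : OreanForm C) : Form C := F.toForm.Subform (fun _ S => F.Conormal S)

/-- The normal hull: the subform of normal clusters. -/
def normalHull (F : OreanForm C) : Form C := F.toForm.Subform (fun _ S => F.Normal S)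

def conormalIncl (F : OreanForm C) : Operator F.conormalHull F.toForm :=
  F.toForm.subformIncl _

def normalIncl (F : OreanForm C) : Operator F.normalHull F.toForm :=
  F.toForm.subformIncl _

/-- A strongly orean form: the conormal and normal hulls are both orean. -/
def StronglyOrean (F : OreanForm C) : Prop :=
  F.conormalHull.IsOrean ∧ F.normalHull.IsOrean

/-- `T` is the conormal interior of `S` (largest conormal cluster below `S`). -/
def IsConormalInterior (F : OreanForm C) {X : C} (S T : F.Cl X) : Prop :=
  F.Conormal T ∧ F.le T S ∧ ∀ T' : F.Cl X, F.Conormal T' → F.le T' S → F.le T' T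

/-- `T` is the conormal exterior of `S` (smallest conormal cluster above `S`). -/
def IsConormalExterior (F : OreanForm C) {X : C} (S T : F.Cl X) : Prop :=
  F.Conormal T ∧ F.le S T ∧ ∀ T' : F.Cl X, F.Conormal T' → F.le S T' → F.le T T'

/-- `T` is the normal interior of `S` (largest normal cluster below `S`). -/
def IsNormalInterior (F : OreanForm C) {X : C} (S T : F.Cl X) : Prop :=
  F.Normal T ∧ F.le T S ∧ ∀ T' : F.Cl X, F.Normal T' → F.le T' S → F.le T' T

/-- `T` is the normal exterior of `S` (smallest normal cluster above `S`). -/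
def IsNormalExterior (F : OreanForm C) {X : C} (S T : F.Cl X) : Prop :=
  F.Normal T ∧ F.le S T ∧ ∀ T' : F.Cl X, F.Normal T' → F.le S T' → F.le T T'

/-- Componentwise product of orean forms. -/
def prod (F G : OreanForm C) : OreanForm C where
  toForm := F.toForm.prod G.toForm
  bot X := (F.bot X, G.bot X)
  top X := (F.top X, G.top X)
  join A B := (F.join A.1 B.1, G.join A.2 B.2)
  meet A B := (F.meet A.1 B.1, G.meet A.2 B.2)
  dimg f S := (F.dimg f S.1, G.dimg f S.2)
  iimg f T := (F.iimg f T.1, G.iimg f T.2)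
  bot_le A := ⟨F.bot_le A.1, G.bot_le A.2⟩
  le_top A := ⟨F.le_top A.1, G.le_top A.2⟩
  le_join_left A B := ⟨F.le_join_left A.1 B.1, G.le_join_left A.2 B.2⟩
  le_join_right A B := ⟨F.le_join_right A.1 B.1, G.le_join_right A.2 B.2⟩
  join_le h h' := ⟨F.join_le h.1 h'.1, G.join_le h.2 h'.2⟩
  meet_le_left A B := ⟨F.meet_le_left A.1 B.1, G.meet_le_left A.2 B.2⟩
  meet_le_right A B := ⟨F.meet_le_right A.1 B.1, G.meet_le_right A.2 B.2⟩
  le_meet h h' := ⟨F.le_meet h.1 h'.1, G.le_meet h.2 h'.2⟩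
  rel_dimg f S := ⟨F.rel_dimg f S.1, G.rel_dimg f S.2⟩
  dimg_le h := ⟨F.dimg_le h.1, G.dimg_le h.2⟩
  iimg_rel f T := ⟨F.iimg_rel f T.1, G.iimg_rel f T.2⟩
  le_iimg h := ⟨F.le_iimg h.1, G.le_iimg h.2⟩
  rel_decomp h := by
    obtain ⟨B1, h1, h1'⟩ := F.rel_decomp h.1
    obtain ⟨B2, h2, h2'⟩ := G.rel_decomp h.2
    exact ⟨(B1, B2), ⟨h1, h2⟩, ⟨h1', h2'⟩⟩

end OreanForm

/-- An orean factorization, stated for orean forms. -/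
def OreanFactorization {C : Type u} [Category.{v} C] (Fs Fe : OreanForm C) : Prop :=
  Fs.IsConormalForm ∧ Fe.IsNormalForm ∧
  ∀ {X Y : C} (f : X ⟶ Y), ∃ (I : C) (e : X ⟶ I) (m : I ⟶ Y),
    Fe.IsQuotient e (Fe.Ker f) ∧ Fs.IsEmbedding m (Fs.Im f) ∧ e ≫ m = f

/-- A conormal operator between orean forms (preserves images). -/
def OpConormal {C : Type u} [Category.{v} C] {Fs Fe : OreanForm C}
    (α : Operator Fs.toForm Fe.toForm) : Prop :=
  ∀ {W X : C} (f : W ⟶ X), α.app (Fs.Im f) = Fe.Im f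

/-- A normal operator between orean forms (preserves kernels). -/
def OpNormal {C : Type u} [Category.{v} C] {Fs Fe : OreanForm C}
    (β : Operator Fs.toForm Fe.toForm) : Prop :=
  ∀ {X Y : C} (g : X ⟶ Y), β.app (Fs.Ker g) = Fe.Ker g

/-- `W` is the Wyler join `A ∗ R = (π_R ·ˢ A) ·ˢ π_R` relative to an orean
factorization `(Fs, Fe)`. -/
def WylerJoin {C : Type u} [Category.{v} C] (Fs Fe : OreanForm C) {X : C}
    (A : Fs.Cl X) (R : Fe.Cl X) (W : Fs.Cl X) : Prop :=
  ∃ (Q : C) (p : X ⟶ Q), Fe.IsQuotient p R ∧ Fs.iimg p (Fs.dimg p A) = W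

section Decomp

variable {C : Type u} [Category.{v} C]

/-- Core of a decomposition: a pair of idempotent operators whose subforms of fixed
clusters are a conormal orean form resp. a normal orean form. -/
def IsDecompCore (F : OreanForm C) (κs κe : Operator F.toForm F.toForm) : Prop :=
  (∀ {X : C} (A : F.Cl X), κs.app (κs.app A) = κs.app A) ∧
  (∀ {X : C} (A : F.Cl X), κe.app (κe.app A) = κe.app A) ∧
  (F.toForm.fixedSubform κs).IsOrean ∧ (F.toForm.fixedSubform κs).IsConormal ∧
  (F.toForm.fixedSubform κe).IsOrean ∧ (F.toForm.fixedSubform κe).IsNormal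

def JoinEq (F : OreanForm C) (κs κe : Operator F.toForm F.toForm) : Prop :=
  ∀ {X : C} (S : F.Cl X), S = F.join (κs.app S) (κe.app S)

def MeetEq (F : OreanForm C) (κs κe : Operator F.toForm F.toForm) : Prop :=
  ∀ {X : C} (S : F.Cl X), S = F.meet (κs.app S) (κe.app S)

def LeftEq (F : OreanForm C) (κs : Operator F.toForm F.toForm) : Prop :=
  ∀ {X : C} (S : F.Cl X), S = κs.app S

def RightEq (F : OreanForm C) (κe : Operator F.toForm F.toForm) : Prop :=
  ∀ {X : C} (S : F.Cl X), S = κe.app S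

def TopEq (F : OreanForm C) : Prop := ∀ {X : C} (S : F.Cl X), S = F.top X

def BotEq (F : OreanForm C) : Prop := ∀ {X : C} (S : F.Cl X), S = F.bot X

/-- A decomposition of an orean form: the decomposing term is one of the six
binary bounded-lattice terms. -/
def IsDecomp (F : OreanForm C) (κs κe : Operator F.toForm F.toForm) : Prop :=
  IsDecompCore F κs κe ∧
  (JoinEq F κs κe ∨ MeetEq F κs κe ∨ LeftEq F κs ∨ RightEq F κe ∨ TopEq F ∨ BotEq F)

def IsJoinDecomp (F : OreanForm C) (κs κe : Operator F.toForm F.toForm) : Prop :=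
  IsDecompCore F κs κe ∧ JoinEq F κs κe

def IsMeetDecomp (F : OreanForm C) (κs κe : Operator F.toForm F.toForm) : Prop :=
  IsDecompCore F κs κe ∧ MeetEq F κs κe

def IsLeftDecomp (F : OreanForm C) (κs κe : Operator F.toForm F.toForm) : Prop :=
  IsDecompCore F κs κe ∧ LeftEq F κs

def IsRightDecomp (F : OreanForm C) (κs κe : Operator F.toForm F.toForm) : Prop :=
  IsDecompCore F κs κe ∧ RightEq F κe

/-- A semiexact decomposition: the decomposition projections are binormal and the pair
of fixed subforms is a semiexact pair. -/
def IsSemiexact (F : OreanForm C) (κs κe : Operator F.toForm F.toForm) : Prop :=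
  (∃ τs : Operator F.toForm (F.toForm.fixedSubform κs),
      (∀ {X : C} (A : F.Cl X), (τs.app A).1 = κs.app A) ∧ τs.Conormal ∧ τs.Normal) ∧
  (∃ τe : Operator F.toForm (F.toForm.fixedSubform κe),
      (∀ {X : C} (A : F.Cl X), (τe.app A).1 = κe.app A) ∧ τe.Conormal ∧ τe.Normal) ∧
  IsSemiexactPair (F.toForm.fixedSubform κs) (F.toForm.fixedSubform κe)

/-- An exact decomposition: semiexact, and the subform inclusions are
conormal resp. normal. -/
def IsExact (F : OreanForm C) (κs κe : Operator F.toForm F.toForm) : Prop :=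
  IsSemiexact F κs κe ∧
  (F.toForm.subformIncl (fun _ A => κs.app A = A)).Conormal ∧
  (F.toForm.subformIncl (fun _ A => κe.app A = A)).Normal

end Decomp

namespace OreanForm

variable {C : Type u} [Category.{v} C]

theorem rel_mono (F : OreanForm C) {X Y : C} {f : X ⟶ Y} {A A' : F.Cl X} {B B' : F.Cl Y}
    (h1 : F.Rel (𝟙 X) A A') (h : F.Rel f A' B) (h2 : F.Rel (𝟙 Y) B B') : F.Rel f A B' := by
  have := F.rel_comp h1 (F.rel_comp h h2)
  simpa using this

theorem rel_of_dimg_le (F : OreanForm C) {X Y : C} {f : X ⟶ Y} {A : F.Cl X} {B : F.Cl Y}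
    (h : F.Rel (𝟙 Y) (F.dimg f A) B) : F.Rel f A B :=
  F.rel_mono (F.rel_id _) (F.rel_dimg f A) h

theorem rel_of_le_iimg (F : OreanForm C) {X Y : C} {f : X ⟶ Y} {A : F.Cl X} {B : F.Cl Y}
    (h : F.Rel (𝟙 X) A (F.iimg f B)) : F.Rel f A B :=
  F.rel_mono h (F.iimg_rel f B) (F.rel_id _)

theorem rel_dimg_of_comp (F : OreanForm C) {X Y Z : C} {f : X ⟶ Y} {g : Y ⟶ Z} {A : F.Cl X}
    {D : F.Cl Z} (h : F.Rel (f ≫ g) A D) : F.Rel g (F.dimg f A) D := by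
  obtain ⟨B, h1, h2⟩ := F.rel_decomp h
  exact F.rel_mono (F.dimg_le h1) h2 (F.rel_id _)

theorem rel_iimg_of_comp (F : OreanForm C) {X Y Z : C} {f : X ⟶ Y} {g : Y ⟶ Z} {A : F.Cl X}
    {D : F.Cl Z} (h : F.Rel (f ≫ g) A D) : F.Rel f A (F.iimg g D) := by
  obtain ⟨B, h1, h2⟩ := F.rel_decomp h
  exact F.rel_mono (F.rel_id _) h1 (F.le_iimg h2)

theorem rel_top (F : OreanForm C) {X Y : C} (f : X ⟶ Y) (A : F.Cl X) : F.Rel f A (F.top Y) :=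
  F.rel_of_dimg_le (F.le_top _)

theorem rel_bot (F : OreanForm C) {X Y : C} (f : X ⟶ Y) (B : F.Cl Y) : F.Rel f (F.bot X) B :=
  F.rel_of_le_iimg (F.bot_le _)

theorem Im_comp (F : OreanForm C) {X Y Z : C} (f : X ⟶ Y) (g : Y ⟶ Z) :
    F.Im (f ≫ g) = F.dimg g (F.Im f) :=
  F.rel_antisymm (F.dimg_le (F.rel_comp (F.rel_dimg _ _) (F.rel_dimg _ _)))
    (F.dimg_le (F.rel_dimg_of_comp (F.rel_dimg _ _)))

theorem Ker_comp (F : OreanForm C) {X Y Z : C} (f : X ⟶ Y) (g : Y ⟶ Z) :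
    F.Ker (f ≫ g) = F.iimg f (F.Ker g) :=
  F.rel_antisymm (F.le_iimg (F.rel_iimg_of_comp (F.iimg_rel _ _)))
    (F.le_iimg (F.rel_comp (F.iimg_rel _ _) (F.iimg_rel _ _)))

theorem Ker_le_comp (F : OreanForm C) {X Y Z : C} (f : X ⟶ Y) (g : Y ⟶ Z) :
    F.le (F.Ker f) (F.Ker (f ≫ g)) :=
  F.le_iimg (F.rel_comp (F.iimg_rel f _) (F.rel_bot g _))

theorem Im_comp_le (F : OreanForm C) {X Y Z : C} (f : X ⟶ Y) (g : Y ⟶ Z) :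
    F.le (F.Im (f ≫ g)) (F.Im g) :=
  F.dimg_le (F.rel_comp (F.rel_top f _) (F.rel_dimg g _))

theorem Im_split_epi (F : OreanForm C) {X Y : C} (f : X ⟶ Y) (g : Y ⟶ X) (h : g ≫ f = 𝟙 Y) :
    F.Im f = F.top Y := by
  apply F.rel_antisymm (F.le_top _)
  have := F.rel_comp (F.rel_top g (F.top Y)) (F.rel_dimg f (F.top X))
  rwa [h] at this

theorem Ker_split_mono (F : OreanForm C) {X Y : C} (f : X ⟶ Y) (g : Y ⟶ X) (h : f ≫ g = 𝟙 X) :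
    F.Ker f = F.bot X := by
  refine F.rel_antisymm ?_ (F.bot_le _)
  have := F.rel_comp (F.iimg_rel f (F.bot Y)) (F.rel_bot g (F.bot X))
  rwa [h] at this

/-- The opposite orean form. -/
def opp (F : OreanForm C) : OreanForm Cᵒᵖ where
  Cl X := F.Cl X.unop
  Rel f A B := F.Rel f.unop B A
  rel_id A := F.rel_id A
  rel_comp h h' := F.rel_comp h' h
  rel_antisymm h h' := F.rel_antisymm h' h
  bot X := F.top X.unop
  top X := F.bot X.unop
  join A B := F.meet A B
  meet A B := F.join A B
  dimg f S := F.iimg f.unop S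
  iimg f S := F.dimg f.unop S
  bot_le A := F.le_top A
  le_top A := F.bot_le A
  le_join_left A B := F.meet_le_left A B
  le_join_right A B := F.meet_le_right A B
  join_le h h' := F.le_meet h h'
  meet_le_left A B := F.le_join_left A B
  meet_le_right A B := F.le_join_right A B
  le_meet h h' := F.join_le h h'
  rel_dimg f S := F.iimg_rel f.unop S
  dimg_le h := F.le_iimg h
  iimg_rel f S := F.rel_dimg f.unop S
  le_iimg h := F.dimg_le h
  rel_decomp h := by
    obtain ⟨B, h1, h2⟩ := F.rel_decomp h
    exact ⟨B, h2, h1⟩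

theorem IsQuotient.opp {F : OreanForm C} {X Y : C} {e : X ⟶ Y} {K : F.Cl X}
    (h : F.IsQuotient e K) : F.opp.IsEmbedding (X := Opposite.op X) e.op K := by
  refine ⟨h.1, fun {W'} f' hf => ?_⟩
  obtain ⟨g, hg, hu⟩ := h.2 f'.unop hf
  refine ⟨g.op, Quiver.Hom.unop_inj hg, fun y hy => ?_⟩
  exact Quiver.Hom.unop_inj (hu y.unop (congrArg Quiver.Hom.unop hy))

theorem IsEmbedding.opp {F : OreanForm C} {X Y : C} {m : X ⟶ Y} {K : F.Cl Y}
    (h : F.IsEmbedding m K) : F.opp.IsQuotient (X := Opposite.op Y) m.op K := by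
  refine ⟨h.1, fun {W'} f' hf => ?_⟩
  obtain ⟨g, hg, hu⟩ := h.2 f'.unop hf
  refine ⟨g.op, Quiver.Hom.unop_inj hg, fun y hy => ?_⟩
  exact Quiver.Hom.unop_inj (hu y.unop (congrArg Quiver.Hom.unop hy))

/-- Quotients of the same cluster differ by an isomorphism. -/
theorem IsQuotient.iso {F : OreanForm C} {X Y Y' : C} {e : X ⟶ Y} {e' : X ⟶ Y'} {K : F.Cl X}
    (h : F.IsQuotient e K) (h' : F.IsQuotient e' K) :
    ∃ (a : Y ⟶ Y') (b : Y' ⟶ Y), e ≫ a = e' ∧ e' ≫ b = e ∧ a ≫ b = 𝟙 _ ∧ b ≫ a = 𝟙 _ := by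
  obtain ⟨a, ha, -⟩ := h.2 e' (by rw [h'.1]; exact F.rel_id _)
  obtain ⟨b, hb, -⟩ := h'.2 e (by rw [h.1]; exact F.rel_id _)
  refine ⟨a, b, ha, hb, ?_, ?_⟩
  · refine (h.2 e (by rw [h.1]; exact F.rel_id _)).unique ?_ ?_
    · rw [← Category.assoc, ha, hb]
    · exact Category.comp_id _
  · refine (h'.2 e' (by rw [h'.1]; exact F.rel_id _)).unique ?_ ?_
    · rw [← Category.assoc, hb, ha]
    · exact Category.comp_id _

theorem IsQuotient.cancel {F : OreanForm C} {X Y Z : C} {e : X ⟶ Y} {K : F.Cl X}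
    (h : F.IsQuotient e K) {a b : Y ⟶ Z} (hab : e ≫ a = e ≫ b) : a = b :=
  (h.2 (e ≫ b) (by rw [← h.1]; exact F.Ker_le_comp _ _)).unique hab rfl

theorem IsEmbedding.cancel {F : OreanForm C} {X Y Z : C} {m : Y ⟶ Z} {K : F.Cl Z}
    (h : F.IsEmbedding m K) {a b : X ⟶ Y} (hab : a ≫ m = b ≫ m) : a = b :=
  (h.2 (b ≫ m) (by rw [← h.1]; exact F.Im_comp_le _ _)).unique hab rfl

/-- A quotient composed with an isomorphism is a quotient. -/
theorem IsQuotient.comp_iso {F : OreanForm C} {X Y Y' : C} {e : X ⟶ Y} {K : F.Cl X}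
    (h : F.IsQuotient e K) (a : Y ⟶ Y') (b : Y' ⟶ Y) (hab : a ≫ b = 𝟙 _) (hba : b ≫ a = 𝟙 _) :
    F.IsQuotient (e ≫ a) K := by
  have hk : F.Ker (e ≫ a) = K := by
    rw [F.Ker_comp, F.Ker_split_mono a b hab, ← h.1]; rfl
  refine ⟨hk, fun {Z} g hg => ?_⟩
  obtain ⟨k, hk1, hk2⟩ := h.2 g hg
  refine ⟨b ≫ k, ?_, fun y hy => ?_⟩
  · show (e ≫ a) ≫ b ≫ k = g
    rw [Category.assoc, ← Category.assoc a, hab, Category.id_comp, hk1]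
  · rw [← hk2 (a ≫ y) (by simpa using hy), ← Category.assoc, hba, Category.id_comp]

end OreanForm

open OreanForm

section OF

variable {C : Type u} [Category.{v} C] {Fs Fe : OreanForm C}

theorem OreanFactorization.opp (h : OreanFactorization Fs Fe) :
    OreanFactorization Fe.opp Fs.opp := by
  refine ⟨fun {X} S => ?_, fun {X} S => ?_, fun {X Y} f => ?_⟩
  · obtain ⟨Y, g, hg⟩ := h.2.1 (X := X.unop) S
    exact ⟨Opposite.op Y, g.op, hg⟩
  · obtain ⟨Y, g, hg⟩ := h.1 (X := X.unop) S
    exact ⟨Opposite.op Y, g.op, hg⟩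
  · obtain ⟨I, e, m, he, hm, hem⟩ := h.2.2 f.unop
    exact ⟨Opposite.op I, m.op, e.op, hm.opp, he.opp, Quiver.Hom.unop_inj hem⟩

theorem OreanFactorization.exists_quot (h : OreanFactorization Fs Fe) {X : C} (R : Fe.Cl X) :
    ∃ (Y : C) (e : X ⟶ Y), Fe.IsQuotient e R := by
  obtain ⟨Y, g, rfl⟩ := h.2.1 R
  obtain ⟨I, e, m, he, -, -⟩ := h.2.2 g
  exact ⟨I, e, he⟩

theorem OreanFactorization.exists_emb (h : OreanFactorization Fs Fe) {X : C} (A : Fs.Cl X) :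
    ∃ (W : C) (m : W ⟶ X), Fs.IsEmbedding m A := by
  obtain ⟨W, f, rfl⟩ := h.1 A
  obtain ⟨I, e, m, -, hm, -⟩ := h.2.2 f
  exact ⟨I, m, hm⟩

theorem OreanFactorization.Ims_quot (h : OreanFactorization Fs Fe) {X Y : C} {e : X ⟶ Y}
    {R : Fe.Cl X} (he : Fe.IsQuotient e R) : Fs.Im e = Fs.top Y := by
  obtain ⟨I, e', m, he', hm, hem⟩ := h.2.2 e
  rw [he.1] at he'
  obtain ⟨a, b, ha, hb, hab, hba⟩ := he.iso he'
  have hma : m = b := he'.cancel (by rw [hem, hb])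
  rw [← hm.1]
  exact Fs.Im_split_epi m a (by rw [hma, hab])

theorem OreanFactorization.quot_comp (h : OreanFactorization Fs Fe) {X Y Z : C} {e : X ⟶ Y}
    {g : Y ⟶ Z} {R : Fe.Cl X} {S : Fe.Cl Y} (he : Fe.IsQuotient e R) (hg : Fe.IsQuotient g S) :
    Fe.IsQuotient (e ≫ g) (Fe.Ker (e ≫ g)) := by
  obtain ⟨I, q, n, hq, hn, hqn⟩ := h.2.2 (e ≫ g)
  have hI : Fs.Im (e ≫ g) = Fs.top Z := by
    rw [Fs.Im_comp, h.Ims_quot he, ← h.Ims_quot hg]; rfl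
  rw [hI] at hn
  obtain ⟨s, hs, -⟩ := hn.2 (𝟙 Z) (Fs.le_top _)
  have hns : n ≫ s = 𝟙 _ := hn.cancel (by rw [Category.assoc, hs]; simp)
  have := hq.comp_iso n s hns hs
  rwa [hqn] at this

theorem OreanFactorization.Ime_quot (h : OreanFactorization Fs Fe) {X Y : C} {e : X ⟶ Y}
    {R : Fe.Cl X} (he : Fe.IsQuotient e R) : Fe.Im e = Fe.top Y := by
  obtain ⟨Q, g, hg⟩ := h.exists_quot (Fe.Im e)
  obtain ⟨T, t, ht⟩ := h.exists_quot (Fe.top Q)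
  have h1 := h.quot_comp he hg
  have h2 := h.quot_comp h1 ht
  have k1 : Fe.Ker (e ≫ g) = Fe.top X := by
    apply Fe.rel_antisymm (Fe.le_top _)
    rw [Fe.Ker_comp, hg.1]
    exact Fe.le_iimg (Fe.rel_dimg _ _)
  have k2 : Fe.Ker ((e ≫ g) ≫ t) = Fe.top X := by
    apply Fe.rel_antisymm (Fe.le_top _)
    rw [← k1]
    exact Fe.Ker_le_comp _ _
  rw [k2] at h2
  rw [k1] at h1
  obtain ⟨a, b, ha, hb, hab, hba⟩ := h1.iso h2
  have hta : t = a := h1.cancel ha.symm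
  have k3 : Fe.top Q = Fe.bot Q := by
    rw [← ht.1]; exact Fe.Ker_split_mono t b (by rw [hta, hab])
  apply Fe.rel_antisymm (Fe.le_top _)
  rw [← hg.1]
  refine Fe.le_iimg ?_
  rw [← k3]
  exact Fe.rel_top _ _

theorem IsEmbedding_Im_unique {X W W' : C} (A : Fs.Cl X) (m : W ⟶ X) (m' : W' ⟶ X)
    (h : Fs.IsEmbedding m A) (h' : Fs.IsEmbedding m' A) : Fe.Im m = Fe.Im m' := by
  obtain ⟨a, ha, -⟩ := h.2 m' (by rw [h'.1]; exact Fs.rel_id _)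
  obtain ⟨b, hb, -⟩ := h'.2 m (by rw [h.1]; exact Fs.rel_id _)
  apply Fe.rel_antisymm
  · have := Fe.Im_comp_le b m'
    rwa [hb] at this
  · have := Fe.Im_comp_le a m
    rwa [ha] at this

theorem OreanFactorization.alpha (h : OreanFactorization Fs Fe) :
    ∃ α : Operator Fs.toForm Fe.toForm,
      (∀ {X W : C} (A : Fs.Cl X) (m : W ⟶ X), Fs.IsEmbedding m A → α.app A = Fe.Im m) ∧
      OpConormal α := by
  choose W m hm using fun (X : C) (A : Fs.Cl X) => h.exists_emb A
  have key : ∀ {X V : C} (A : Fs.Cl X) (n : V ⟶ X), Fs.IsEmbedding n A →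
      Fe.Im (m X A) = Fe.Im n := fun A n hn => IsEmbedding_Im_unique A _ _ (hm _ A) hn
  refine ⟨⟨fun {X} A => Fe.Im (m X A), ?_⟩, key, ?_⟩
  · intro X Y f A B hAB
    have h1 : Fs.le (Fs.Im (m X A ≫ f)) B := by
      rw [Fs.Im_comp, (hm X A).1]
      exact Fs.dimg_le hAB
    obtain ⟨g, hg, -⟩ := (hm Y B).2 _ h1
    apply Fe.rel_dimg_of_comp
    rw [← hg]
    exact Fe.rel_comp (Fe.rel_top g _) (Fe.rel_dimg _ _)
  · intro V X f
    obtain ⟨I, e, n, he, hn, hen⟩ := h.2.2 f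
    show Fe.Im (m X (Fs.Im f)) = _
    rw [key _ n hn, ← hen, Fe.Im_comp, h.Ime_quot he]
    rfl

theorem OreanForm.isOrean (F : OreanForm C) : F.toForm.IsOrean :=
  ⟨fun X => ⟨F.bot X, F.bot_le⟩, fun X => ⟨F.top X, F.le_top⟩,
    fun _ A B => ⟨F.join A B, F.le_join_left A B, F.le_join_right A B, fun _ => F.join_le⟩,
    fun _ A B => ⟨F.meet A B, F.meet_le_left A B, F.meet_le_right A B, fun _ => F.le_meet⟩,
    fun f S => ⟨F.dimg f S, F.rel_dimg f S, fun _ => F.dimg_le⟩,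
    fun f S => ⟨F.iimg f S, F.iimg_rel f S, fun _ => F.le_iimg⟩,
    fun _ _ _ _ => F.rel_decomp⟩

theorem OreanForm.isImageOf_Im (F : OreanForm C) {X Y : C} (f : X ⟶ Y) :
    F.toForm.IsImageOf (F.Im f) f :=
  ⟨F.top X, F.le_top, F.rel_dimg _ _, fun _ => F.dimg_le⟩

theorem OreanForm.isKernelOf_Ker (F : OreanForm C) {X Y : C} (f : X ⟶ Y) :
    F.toForm.IsKernelOf (F.Ker f) f :=
  ⟨F.bot Y, F.bot_le, F.iimg_rel _ _, fun _ => F.le_iimg⟩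

theorem OreanForm.eq_Im (F : OreanForm C) {X Y : C} {f : X ⟶ Y} {S : F.Cl Y}
    (h : F.toForm.IsImageOf S f) : S = F.Im f := by
  obtain ⟨t, ht, h1, h2⟩ := h
  obtain rfl : t = F.top X := F.rel_antisymm (F.le_top _) (ht _)
  exact F.rel_antisymm (h2 _ (F.rel_dimg _ _)) (F.dimg_le h1)

theorem OreanForm.eq_Ker (F : OreanForm C) {X Y : C} {f : X ⟶ Y} {S : F.Cl X}
    (h : F.toForm.IsKernelOf S f) : S = F.Ker f := by
  obtain ⟨t, ht, h1, h2⟩ := h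
  obtain rfl : t = F.bot Y := F.rel_antisymm (ht _) (F.bot_le _)
  exact F.rel_antisymm (F.le_iimg h1) (h2 _ (F.iimg_rel _ _))

end OF

/-- Theorem: every orean factorization `(Fs, Fe)` is a semiexact pair; the conormal
operator `α` is well-defined by `α A = Im^e (ι^s_A)` and the normal operator `β` is
well-defined by `β R = Ker^s (π^e_R)`. -/
theorem orean_factorization_semiexact {C : Type u} [Category.{v} C]
    (Fs Fe : OreanForm C) (h : OreanFactorization Fs Fe) :
    (∀ {X W W' : C} (A : Fs.Cl X) (m : W ⟶ X) (m' : W' ⟶ X),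
      Fs.IsEmbedding m A → Fs.IsEmbedding m' A → Fe.Im m = Fe.Im m') ∧
    (∃ α : Operator Fs.toForm Fe.toForm,
      (∀ {X W : C} (A : Fs.Cl X) (m : W ⟶ X), Fs.IsEmbedding m A → α.app A = Fe.Im m) ∧
      OpConormal α) ∧
    (∀ {X Y Y' : C} (R : Fe.Cl X) (p : X ⟶ Y) (p' : X ⟶ Y'),
      Fe.IsQuotient p R → Fe.IsQuotient p' R → Fs.Ker p = Fs.Ker p') ∧
    (∃ β : Operator Fe.toForm Fs.toForm,
      (∀ {X Y : C} (R : Fe.Cl X) (p : X ⟶ Y), Fe.IsQuotient p R → β.app R = Fs.Ker p) ∧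
      OpNormal β) ∧
    IsSemiexactPair Fs.toForm Fe.toForm := by
  have hβ : ∃ β : Operator Fe.toForm Fs.toForm,
      (∀ {X Y : C} (R : Fe.Cl X) (p : X ⟶ Y), Fe.IsQuotient p R → β.app R = Fs.Ker p) ∧
      OpNormal β := by
    obtain ⟨γ, hγ, hc⟩ := h.opp.alpha
    refine ⟨⟨fun {X} A => γ.app (X := Opposite.op X) A, fun {X Y f A B} hAB =>
      γ.mono (f := f.op) (A := B) (B := A) hAB⟩, ?_, ?_⟩
    · intro X Y R p hp
      exact hγ (X := Opposite.op X) R p.op hp.opp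
    · intro X Y g
      exact hc g.op
  have hα := h.alpha
  refine ⟨fun A m m' => IsEmbedding_Im_unique A m m', hα, ?_, hβ, ?_⟩
  · intro X Y Y' R p p' hp hp'
    exact IsEmbedding_Im_unique (Fs := Fe.opp) (Fe := Fs.opp) (X := Opposite.op X) R p.op p'.op
      hp.opp hp'.opp
  · refine ⟨Fs.isOrean, ?_, Fe.isOrean, ?_, ?_, ?_⟩
    · intro X S
      obtain ⟨W, f, rfl⟩ := h.1 S
      exact ⟨W, f, Fs.isImageOf_Im f⟩
    · intro X S
      obtain ⟨W, f, rfl⟩ := h.2.1 S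
      exact ⟨W, f, Fe.isKernelOf_Ker f⟩
    · obtain ⟨α, -, hc⟩ := hα
      refine ⟨α, fun f S hS => ?_⟩
      rw [Fs.eq_Im hS, hc f]
      exact Fe.isImageOf_Im f
    · obtain ⟨β, -, hc⟩ := hβ
      refine ⟨β, fun f S hS => ?_⟩
      rw [Fe.eq_Ker hS, hc f]
      exact Fs.isKernelOf_Ker f
end

section
/- Let (F_s, F_e) be an orean factorization of a category C. If the axiom (N1) holds in the form F_s for all F_e-quotients (i.e., for every F_e-quotient e, (e ·^s S) ·^s e = S ∨ Ker^s e for all F_s-clusters S in the domain of e, and e ·^s (T ·^s e) = T ∧ Im^s e for all F_s-clusters T in the codomain of e), then (N1) holds in F_s for all morphisms of C. -/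
open CategoryTheory

universe w v u

namespace OreanForm

variable {C : Type u} [Category.{v} C]

theorem aux_post (F : OreanForm C) {X Y : C} {f : X ⟶ Y} {A : F.Cl X} {B D : F.Cl Y}
    (h : F.Rel f A B) (h' : F.Rel (𝟙 Y) B D) : F.Rel f A D := by
  have := F.rel_comp h h'
  rwa [Category.comp_id] at this

theorem aux_pre (F : OreanForm C) {X Y : C} {f : X ⟶ Y} {A B : F.Cl X} {D : F.Cl Y}
    (h : F.Rel (𝟙 X) A B) (h' : F.Rel f B D) : F.Rel f A D := by
  have := F.rel_comp h h'
  rwa [Category.id_comp] at this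

theorem aux_bot (F : OreanForm C) {X Y : C} (f : X ⟶ Y) (T : F.Cl Y) :
    F.Rel f (F.bot X) T :=
  F.aux_pre (F.bot_le _) (F.iimg_rel f T)

theorem aux_Im_comp_le (F : OreanForm C) {X Y Z : C} (f : X ⟶ Y) (g : Y ⟶ Z) :
    F.Rel (𝟙 Z) (F.Im (f ≫ g)) (F.Im g) :=
  F.dimg_le (F.rel_comp (F.aux_post (F.rel_dimg f (F.top X)) (F.le_top _))
    (F.rel_dimg g (F.top Y)))

/-- Quotients have full image. -/
theorem aux_quot_top {Fs Fe : OreanForm C} (h : OreanFactorization Fs Fe) {X Y : C}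
    (e : X ⟶ Y) (R : Fe.Cl X) (he : Fe.IsQuotient e R) (A : Fs.Cl Y) :
    Fs.Rel (𝟙 Y) A (Fs.Im e) := by
  obtain ⟨I, e1, m1, hq, hm, hf⟩ := h.2.2 e
  have hR : R = Fe.Ker e := he.1.symm
  subst hR
  obtain ⟨k, hk, -⟩ := he.2 e1 (by rw [hq.1]; exact Fe.rel_id _)
  have h1 : k ≫ m1 = 𝟙 Y := by
    obtain ⟨z, -, hz⟩ := he.2 e (Fe.rel_id _)
    rw [hz (k ≫ m1) (by simp only [← Category.assoc, hk, hf]), hz (𝟙 Y) (by simp)]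
  rw [← hm.1, ← h1]
  exact Fs.rel_comp (Fs.aux_post (Fs.rel_dimg k A) (Fs.le_top _)) (Fs.rel_dimg m1 _)

/-- Embeddings reflect the order of clusters. -/
theorem aux_emb {Fs Fe : OreanForm C} (h : OreanFactorization Fs Fe) {X Y : C}
    (m : X ⟶ Y) (S : Fs.Cl Y) (hm : Fs.IsEmbedding m S) (A B : Fs.Cl X)
    (hAB : Fs.Rel m B (Fs.dimg m A)) : Fs.Rel (𝟙 X) B A := by
  have hS : S = Fs.Im m := hm.1.symm
  subst hS
  obtain ⟨W, a, rfl⟩ := h.1 A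
  obtain ⟨V, b, rfl⟩ := h.1 B
  obtain ⟨I, e', m', hq, hm', hf⟩ := h.2.2 (a ≫ m)
  have hA : Fs.Rel (𝟙 Y) (Fs.dimg m (Fs.Im a)) (Fs.Im (a ≫ m)) := by
    obtain ⟨D, h1, h2⟩ := Fs.rel_decomp (Fs.rel_dimg (a ≫ m) (Fs.top W))
    exact Fs.dimg_le (Fs.aux_pre (Fs.dimg_le h1) h2)
  obtain ⟨g, hg, -⟩ := hm'.2 (b ≫ m) (Fs.dimg_le
    (Fs.aux_post (Fs.rel_comp (Fs.rel_dimg b _) hAB) hA))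
  obtain ⟨k, hk, -⟩ := hm.2 m' (by rw [hm'.1]; exact Fs.aux_Im_comp_le a m)
  have hmono : ∀ {Z : C} (p q : Z ⟶ X), p ≫ m = q ≫ m → p = q := by
    intro Z p q hpq
    obtain ⟨z, -, hz⟩ := hm.2 (q ≫ m) (Fs.aux_Im_comp_le q m)
    rw [hz p hpq, hz q rfl]
  have ha : e' ≫ k = a := hmono _ _ (by rw [Category.assoc, hk, hf])
  have hb : g ≫ k = b := hmono _ _ (by rw [Category.assoc, hk, hg])
  have hka : Fs.Rel k (Fs.top I) (Fs.Im a) := by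
    have h0 := Fs.rel_dimg a (Fs.top W)
    change Fs.Rel a _ (Fs.Im a) at h0
    have h0' : Fs.Rel (e' ≫ k) (Fs.top W) (Fs.Im a) := by rw [ha]; exact h0
    obtain ⟨D, h1, h2⟩ := Fs.rel_decomp h0'
    exact Fs.aux_pre (Fs.aux_post (aux_quot_top h e' _ hq _) (Fs.dimg_le h1)) h2
  apply Fs.dimg_le
  rw [← hb]
  exact Fs.rel_comp (Fs.aux_post (Fs.rel_dimg g _) (Fs.le_top _)) hka

end OreanForm

/-- Theorem: for an orean factorization `(Fs, Fe)`, if (N1) holds in `Fs` at every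
`Fe`-quotient, then (N1) holds in `Fs` at every morphism. -/
theorem n1_of_n1_at_quotients {C : Type u} [Category.{v} C]
    (Fs Fe : OreanForm C) (h : OreanFactorization Fs Fe)
    (hq : ∀ {X Y : C} (e : X ⟶ Y), (∃ R : Fe.Cl X, Fe.IsQuotient e R) → Fs.N1At e) :
    ∀ {X Y : C} (f : X ⟶ Y), Fs.N1At f := by
  intro X Y f
  obtain ⟨I, e, m, he, hm, hf⟩ := h.2.2 f
  obtain ⟨n1, n2⟩ := hq e ⟨_, he⟩
  have hker : Fs.Rel (𝟙 X) (Fs.Ker e) (Fs.Ker f) := by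
    apply Fs.le_iimg
    rw [← hf]
    exact Fs.rel_comp (Fs.iimg_rel e _) (Fs.aux_bot m _)
  refine ⟨fun S => Fs.rel_antisymm ?_ ?_, fun T => Fs.rel_antisymm ?_ ?_⟩
  · have h0 := Fs.iimg_rel f (Fs.dimg f S)
    have hle : Fs.Rel (𝟙 Y) (Fs.dimg f S) (Fs.dimg m (Fs.dimg e S)) := by
      apply Fs.dimg_le
      rw [← hf]
      exact Fs.rel_comp (Fs.rel_dimg e S) (Fs.rel_dimg m _)
    have h0' : Fs.Rel (e ≫ m) (Fs.iimg f (Fs.dimg f S)) (Fs.dimg f S) := by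
      rw [hf]; exact h0
    obtain ⟨B, h1, h2⟩ := Fs.rel_decomp h0'
    have h3 := OreanForm.aux_emb h m _ hm _ _ (Fs.aux_post h2 hle)
    have h4 := Fs.le_iimg (Fs.aux_post h1 h3)
    rw [n1] at h4
    exact Fs.aux_post h4 (Fs.join_le (Fs.le_join_left _ _)
      (Fs.aux_post hker (Fs.le_join_right _ _)))
  · exact Fs.join_le (Fs.le_iimg (Fs.rel_dimg f S))
      (Fs.le_iimg (Fs.aux_post (Fs.iimg_rel f _) (Fs.bot_le _)))
  · exact Fs.le_meet (Fs.dimg_le (Fs.iimg_rel f T))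
      (Fs.dimg_le (Fs.aux_pre (Fs.le_top _) (Fs.rel_dimg f (Fs.top X))))
  · obtain ⟨W, a, ha⟩ := h.1 (Fs.meet T (Fs.Im f))
    obtain ⟨k, hk, -⟩ := hm.2 a (by rw [ha]; exact Fs.meet_le_right _ _)
    have hB : Fs.Rel m (Fs.Im k) T := by
      have h0 : Fs.Rel (k ≫ m) (Fs.top W) T := by
        rw [hk]
        refine Fs.aux_post (Fs.rel_dimg a _) ?_
        change Fs.Rel _ (Fs.Im a) T
        rw [ha]; exact Fs.meet_le_left _ _
      obtain ⟨D, h1, h2⟩ := Fs.rel_decomp h0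
      exact Fs.aux_pre (Fs.dimg_le h1) h2
    have h1 : Fs.Rel (𝟙 X) (Fs.iimg e (Fs.Im k)) (Fs.iimg f T) := by
      apply Fs.le_iimg
      rw [← hf]
      exact Fs.rel_comp (Fs.iimg_rel e _) hB
    have h2 := Fs.aux_pre h1 (Fs.rel_dimg f _)
    have h2' : Fs.Rel (e ≫ m) (Fs.iimg e (Fs.Im k)) (Fs.dimg f (Fs.iimg f T)) := by
      rw [hf]; exact h2
    obtain ⟨D, h3, h4⟩ := Fs.rel_decomp h2'
    have h5 := Fs.dimg_le h3
    rw [n2] at h5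
    have h6 := Fs.aux_post (Fs.le_meet (Fs.rel_id _)
      (OreanForm.aux_quot_top h e _ he (Fs.Im k))) h5
    rw [← ha]
    apply Fs.dimg_le
    rw [← hk]
    exact Fs.rel_comp (Fs.rel_dimg k _) (Fs.aux_pre h6 h4)
end

section
/- Let F be an orean form and let κ be a binormal idempotent closure operator on F. Then: (i) if F satisfies (N3), then the subform F_κ of κ-closed clusters satisfies (N3); (ii) F satisfies (N2) if and only if F_κ satisfies (N2); (iii) F_κ satisfies (N1) if and only if for F the following two implications hold: if S = κS ≥ Ker f then (κ(f·S))·f = S, and if Im f ≥ T = κT then κ(f·(T·f)) = T; (iv) if F satisfies (N1), then F_κ satisfies (N1) if and only if for every morphism f : X → Y, the direct image along f of every κ-closed cluster S ≥ Ker f is κ-closed. -/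
open CategoryTheory

universe w v u

namespace ClosedSub

variable {C : Type u} [Category.{v} C]

lemma rel_le (F : Form C) {X Y : C} {f : X ⟶ Y} {A : F.Cl X} {B D : F.Cl Y}
    (h : F.Rel f A B) (h' : F.Rel (𝟙 Y) B D) : F.Rel f A D := by
  have := F.rel_comp h h'
  rwa [Category.comp_id] at this

lemma le_rel (F : Form C) {X Y : C} {f : X ⟶ Y} {A B : F.Cl X} {D : F.Cl Y}
    (h : F.Rel (𝟙 X) A B) (h' : F.Rel f B D) : F.Rel f A D := by
  have := F.rel_comp h h'
  rwa [Category.id_comp] at this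

lemma rel_iff_dimg (F : OreanForm C) {X Y : C} {f : X ⟶ Y} {A : F.Cl X} {B : F.Cl Y} :
    F.Rel f A B ↔ F.Rel (𝟙 Y) (F.dimg f A) B :=
  ⟨F.dimg_le, fun h => rel_le F.toForm (F.rel_dimg f A) h⟩

lemma rel_iff_iimg (F : OreanForm C) {X Y : C} {f : X ⟶ Y} {A : F.Cl X} {B : F.Cl Y} :
    F.Rel f A B ↔ F.Rel (𝟙 X) A (F.iimg f B) :=
  ⟨F.le_iimg, fun h => le_rel F.toForm h (F.iimg_rel f B)⟩

lemma dimg_le_im (F : OreanForm C) {X Y : C} (f : X ⟶ Y) (A : F.Cl X) :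
    F.Rel (𝟙 Y) (F.dimg f A) (F.Im f) :=
  F.dimg_le (le_rel F.toForm (F.le_top A) (F.rel_dimg f _))

lemma ker_le_iimg (F : OreanForm C) {X Y : C} (f : X ⟶ Y) (B : F.Cl Y) :
    F.Rel (𝟙 X) (F.Ker f) (F.iimg f B) :=
  F.le_iimg (rel_le F.toForm (F.iimg_rel f _) (F.bot_le B))

section
variable (F : OreanForm C) (κ : Operator F.toForm F.toForm)

lemma app_le {X : C} {A B : F.Cl X} (hB : κ.app B = B) (h : F.Rel (𝟙 X) A B) :
    F.Rel (𝟙 X) (κ.app A) B := by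
  have := κ.mono h
  rwa [hB] at this

lemma bot_closed
    (hnorm : @OpNormal _ _ F F κ)
    (X : C) : κ.app (F.bot X) = F.bot X := by
  have h : F.Ker (𝟙 X) = F.bot X := F.rel_antisymm (F.iimg_rel _ _) (F.bot_le _)
  rw [← h]; exact hnorm _

lemma top_closed
    (hclos : ∀ {X : C} (A : F.Cl X), F.le A (κ.app A))
    (X : C) : κ.app (F.top X) = F.top X :=
  F.rel_antisymm (F.le_top _) (hclos _)

lemma iimg_closed
    (hclos : ∀ {X : C} (A : F.Cl X), F.le A (κ.app A))
    {X Y : C} (f : X ⟶ Y) {T : F.Cl Y} (hT : κ.app T = T) :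
    κ.app (F.iimg f T) = F.iimg f T := by
  refine F.rel_antisymm (F.le_iimg ?_) (hclos _)
  have := κ.mono (F.iimg_rel f T)
  rwa [hT] at this

lemma meet_closed
    (hclos : ∀ {X : C} (A : F.Cl X), F.le A (κ.app A))
    {X : C} {A B : F.Cl X} (hA : κ.app A = A) (hB : κ.app B = B) :
    κ.app (F.meet A B) = F.meet A B :=
  F.rel_antisymm (F.le_meet (app_le F κ hA (F.meet_le_left _ _))
    (app_le F κ hB (F.meet_le_right _ _))) (hclos _)

lemma dimgG
    (hclos : ∀ {X : C} (A : F.Cl X), F.le A (κ.app A))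
    (hidem : ∀ {X : C} (A : F.Cl X), κ.app (κ.app A) = κ.app A)
    {X Y : C} (f : X ⟶ Y) (S : (F.toForm.fixedSubform κ).Cl X)
    (T : (F.toForm.fixedSubform κ).Cl Y) :
    (F.toForm.fixedSubform κ).IsDimgOf f S T ↔ T.1 = κ.app (F.dimg f S.1) := by
  constructor
  · rintro ⟨h, h'⟩
    refine F.rel_antisymm (h' ⟨_, hidem _⟩ ?_) (app_le F κ T.2 (F.dimg_le h))
    exact rel_le F.toForm (F.rel_dimg f S.1) (hclos _)
  · intro h
    refine ⟨?_, fun T' hT' => ?_⟩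
    · change F.Rel f S.1 T.1
      rw [h]
      exact rel_le F.toForm (F.rel_dimg f S.1) (hclos _)
    · change F.Rel _ T.1 T'.1
      rw [h]
      exact app_le F κ T'.2 (F.dimg_le hT')

lemma iimgG
    (hclos : ∀ {X : C} (A : F.Cl X), F.le A (κ.app A))
    {X Y : C} (f : X ⟶ Y) (T : (F.toForm.fixedSubform κ).Cl Y)
    (S : (F.toForm.fixedSubform κ).Cl X) :
    (F.toForm.fixedSubform κ).IsIimgOf f T S ↔ S.1 = F.iimg f T.1 := by
  constructor
  · rintro ⟨h, h'⟩
    exact F.rel_antisymm (F.le_iimg h)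
      (h' ⟨_, iimg_closed F κ hclos f T.2⟩ (F.iimg_rel f T.1))
  · intro h
    refine ⟨?_, fun T' hT' => ?_⟩
    · change F.Rel f S.1 T.1
      rw [h]
      exact F.iimg_rel _ _
    · change F.Rel _ T'.1 S.1
      rw [h]
      exact F.le_iimg hT'

lemma imG
    (hclos : ∀ {X : C} (A : F.Cl X), F.le A (κ.app A))
    (hidem : ∀ {X : C} (A : F.Cl X), κ.app (κ.app A) = κ.app A)
    (hconorm : @OpConormal _ _ F F κ)
    {X Y : C} (f : X ⟶ Y) (T : (F.toForm.fixedSubform κ).Cl Y) :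
    (F.toForm.fixedSubform κ).IsImageOf T f ↔ T.1 = F.Im f := by
  have key := dimgG F κ hclos hidem f ⟨F.top X, top_closed F κ hclos X⟩ T
  have e : κ.app (F.dimg f (F.top X)) = F.Im f := hconorm f
  rw [e] at key
  rw [← key]
  constructor
  · rintro ⟨t, ht, h⟩
    have : t = ⟨F.top X, top_closed F κ hclos X⟩ :=
      Subtype.ext (F.rel_antisymm (F.le_top _) (ht ⟨F.top X, top_closed F κ hclos X⟩))
    subst this
    exact h
  · intro h
    exact ⟨⟨F.top X, top_closed F κ hclos X⟩, fun A => F.le_top A.1, h⟩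

lemma kerG
    (hclos : ∀ {X : C} (A : F.Cl X), F.le A (κ.app A))
    (hnorm : @OpNormal _ _ F F κ)
    {X Y : C} (f : X ⟶ Y) (S : (F.toForm.fixedSubform κ).Cl X) :
    (F.toForm.fixedSubform κ).IsKernelOf S f ↔ S.1 = F.Ker f := by
  have key := iimgG F κ hclos f ⟨F.bot Y, bot_closed F κ hnorm Y⟩ S
  change _ ↔ S.1 = F.Ker f at key
  rw [← key]
  constructor
  · rintro ⟨t, ht, h⟩
    have : t = ⟨F.bot Y, bot_closed F κ hnorm Y⟩ :=
      Subtype.ext (F.rel_antisymm (ht ⟨F.bot Y, bot_closed F κ hnorm Y⟩) (F.bot_le _))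
    subst this
    exact h
  · intro h
    exact ⟨⟨F.bot Y, bot_closed F κ hnorm Y⟩, fun A => F.bot_le A.1, h⟩

lemma joinG
    (hclos : ∀ {X : C} (A : F.Cl X), F.le A (κ.app A))
    (hidem : ∀ {X : C} (A : F.Cl X), κ.app (κ.app A) = κ.app A)
    {X : C} (A B J : (F.toForm.fixedSubform κ).Cl X) :
    (F.toForm.fixedSubform κ).IsJoinOf A B J ↔ J.1 = κ.app (F.join A.1 B.1) := by
  constructor
  · rintro ⟨h1, h2, h3⟩
    exact F.rel_antisymm (h3 ⟨_, hidem _⟩ (rel_le F.toForm (F.le_join_left _ _) (hclos _))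
      (rel_le F.toForm (F.le_join_right _ _) (hclos _))) (app_le F κ J.2 (F.join_le h1 h2))
  · intro h
    refine ⟨?_, ?_, fun D h1 h2 => ?_⟩
    · change F.Rel _ A.1 J.1
      rw [h]; exact rel_le F.toForm (F.le_join_left _ _) (hclos _)
    · change F.Rel _ B.1 J.1
      rw [h]; exact rel_le F.toForm (F.le_join_right _ _) (hclos _)
    · change F.Rel _ J.1 D.1
      rw [h]; exact app_le F κ D.2 (F.join_le h1 h2)

lemma meetG
    (hclos : ∀ {X : C} (A : F.Cl X), F.le A (κ.app A))
    {X : C} (A B M : (F.toForm.fixedSubform κ).Cl X) :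
    (F.toForm.fixedSubform κ).IsMeetOf A B M ↔ M.1 = F.meet A.1 B.1 := by
  constructor
  · rintro ⟨h1, h2, h3⟩
    exact F.rel_antisymm (F.le_meet h1 h2)
      (h3 ⟨_, meet_closed F κ hclos A.2 B.2⟩ (F.meet_le_left _ _) (F.meet_le_right _ _))
  · intro h
    refine ⟨?_, ?_, fun D h1 h2 => ?_⟩
    · change F.Rel _ M.1 A.1
      rw [h]; exact F.meet_le_left _ _
    · change F.Rel _ M.1 B.1
      rw [h]; exact F.meet_le_right _ _
    · change F.Rel _ D.1 M.1
      rw [h]; exact F.le_meet h1 h2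

lemma n3
    (hclos : ∀ {X : C} (A : F.Cl X), F.le A (κ.app A))
    (hidem : ∀ {X : C} (A : F.Cl X), κ.app (κ.app A) = κ.app A)
    (hconorm : @OpConormal _ _ F F κ)
    (hnorm : @OpNormal _ _ F F κ)
    (h : F.N3) : (F.toForm.fixedSubform κ).N3 := by
  constructor
  · rintro X S T J ⟨Y, g, hg⟩ ⟨Y', g', hg'⟩ hJ
    rw [kerG F κ hclos hnorm] at hg hg'
    rw [joinG F κ hclos hidem] at hJ
    obtain ⟨Z, k, hk⟩ := h.1 S.1 T.1 ⟨Y, g, hg.symm⟩ ⟨Y', g', hg'.symm⟩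
    refine ⟨Z, k, (kerG F κ hclos hnorm k J).2 ?_⟩
    rw [hJ, ← hk]
    exact hnorm k
  · rintro X S T M ⟨Y, g, hg⟩ ⟨Y', g', hg'⟩ hM
    rw [imG F κ hclos hidem hconorm] at hg hg'
    rw [meetG F κ hclos] at hM
    obtain ⟨Z, k, hk⟩ := h.2 S.1 T.1 ⟨Y, g, hg.symm⟩ ⟨Y', g', hg'.symm⟩
    exact ⟨Z, k, (imG F κ hclos hidem hconorm k M).2 (hM.trans hk.symm)⟩

lemma n2
    (hclos : ∀ {X : C} (A : F.Cl X), F.le A (κ.app A))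
    (hidem : ∀ {X : C} (A : F.Cl X), κ.app (κ.app A) = κ.app A)
    (hconorm : @OpConormal _ _ F F κ)
    (hnorm : @OpNormal _ _ F F κ)
    : F.N2 ↔ (F.toForm.fixedSubform κ).N2 := by
  constructor
  · intro h X Y f
    obtain ⟨I, e, m, ⟨he, he'⟩, ⟨hm, hm'⟩, hf⟩ := h f
    refine ⟨I, e, m, ⟨F.Ker f, hnorm f⟩, ⟨F.Im f, hconorm f⟩, ?_, ⟨?_, ?_⟩, ?_, ⟨?_, ?_⟩, hf⟩
    · exact (kerG F κ hclos hnorm _ _).2 rfl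
    · exact (kerG F κ hclos hnorm _ _).2 he.symm
    · intro Y' g' K' hK' hle
      rw [kerG F κ hclos hnorm] at hK'
      exact he' g' (hK' ▸ hle)
    · exact (imG F κ hclos hidem hconorm _ _).2 rfl
    · exact (imG F κ hclos hidem hconorm _ _).2 hm.symm
    · intro Y' g' K' hK' hle
      rw [imG F κ hclos hidem hconorm] at hK'
      exact hm' g' (hK' ▸ hle)
  · intro h X Y f
    obtain ⟨I, e, m, K, S, hK, ⟨he, he'⟩, hS, ⟨hm, hm'⟩, hf⟩ := h f
    rw [kerG F κ hclos hnorm] at hK he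
    rw [imG F κ hclos hidem hconorm] at hS hm
    refine ⟨I, e, m, ⟨he.symm.trans hK, ?_⟩, ⟨hm.symm.trans hS, ?_⟩, hf⟩
    · intro Y' g' hle
      refine he' g' ⟨F.Ker g', hnorm g'⟩ ((kerG F κ hclos hnorm _ _).2 rfl) ?_
      change F.Rel _ K.1 _
      rw [hK]; exact hle
    · intro Y' g' hle
      refine hm' g' ⟨F.Im g', hconorm g'⟩ ((imG F κ hclos hidem hconorm _ _).2 rfl) ?_
      change F.Rel _ _ S.1
      rw [hS]; exact hle

lemma n1
    (hclos : ∀ {X : C} (A : F.Cl X), F.le A (κ.app A))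
    (hidem : ∀ {X : C} (A : F.Cl X), κ.app (κ.app A) = κ.app A)
    (hconorm : @OpConormal _ _ F F κ)
    (hnorm : @OpNormal _ _ F F κ)
    : (F.toForm.fixedSubform κ).N1 ↔
      ((∀ {X Y : C} (f : X ⟶ Y) (S : F.Cl X), κ.app S = S → F.le (F.Ker f) S →
          F.iimg f (κ.app (F.dimg f S)) = S) ∧
        (∀ {X Y : C} (f : X ⟶ Y) (T : F.Cl Y), κ.app T = T → F.le T (F.Im f) →
          κ.app (F.dimg f (F.iimg f T)) = T)) := by
  constructor
  · rintro ⟨h1, h2⟩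
    constructor
    · intro X Y f S hS hle
      have hj : F.join S (F.Ker f) = S :=
        F.rel_antisymm (F.join_le (F.rel_id S) hle) (F.le_join_left _ _)
      have := h1 f ⟨S, hS⟩ ⟨_, iimg_closed F κ hclos f (hidem (F.dimg f S))⟩
        ⟨_, hidem (F.dimg f S)⟩ ⟨F.Ker f, hnorm f⟩ ⟨S, hS⟩
        ((dimgG F κ hclos hidem _ _ _).2 rfl) ((iimgG F κ hclos _ _ _).2 rfl)
        ((kerG F κ hclos hnorm _ _).2 rfl)
        ((joinG F κ hclos hidem _ _ _).2 (by change S = κ.app (F.join S (F.Ker f)); rw [hj, hS]))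
      exact congrArg Subtype.val this
    · intro X Y f T hT hle
      have hj : F.meet T (F.Im f) = T :=
        F.rel_antisymm (F.meet_le_left _ _) (F.le_meet (F.rel_id T) hle)
      have := h2 f ⟨T, hT⟩ ⟨_, iimg_closed F κ hclos f hT⟩
        ⟨_, hidem (F.dimg f (F.iimg f T))⟩ ⟨F.Im f, hconorm f⟩ ⟨T, hT⟩
        ((iimgG F κ hclos _ _ _).2 rfl) ((dimgG F κ hclos hidem _ _ _).2 rfl)
        ((imG F κ hclos hidem hconorm _ _).2 rfl)
        ((meetG F κ hclos _ _ _).2 hj.symm)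
      exact congrArg Subtype.val this
  · rintro ⟨h1, h2⟩
    constructor
    · intro X Y f S V T K J hT hV hK hJ
      rw [dimgG F κ hclos hidem] at hT
      rw [iimgG F κ hclos] at hV
      rw [kerG F κ hclos hnorm] at hK
      rw [joinG F κ hclos hidem] at hJ
      have hSJ : F.Rel (𝟙 X) S.1 J.1 := by
        rw [hJ]; exact rel_le F.toForm (F.le_join_left _ _) (hclos _)
      have hKJ : F.Rel (𝟙 X) (F.Ker f) J.1 := by
        rw [hJ, ← hK]; exact rel_le F.toForm (F.le_join_right _ _) (hclos _)
      apply Subtype.ext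
      apply F.rel_antisymm
      · rw [← h1 f J.1 J.2 hKJ, hV, hT]
        apply F.le_iimg
        refine rel_le F.toForm (F.iimg_rel _ _) (κ.mono (F.dimg_le ?_))
        exact le_rel F.toForm hSJ (F.rel_dimg _ _)
      · rw [hJ]
        refine app_le F κ V.2 (F.join_le ?_ ?_)
        · rw [hV, hT]
          exact F.le_iimg (rel_le F.toForm (F.rel_dimg _ _) (hclos _))
        · rw [hK, hV]
          exact ker_le_iimg F f _
    · intro X Y f T S U I M hS hU hI hM
      rw [iimgG F κ hclos] at hS
      rw [dimgG F κ hclos hidem] at hU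
      rw [imG F κ hclos hidem hconorm] at hI
      rw [meetG F κ hclos] at hM
      have hMT : F.Rel (𝟙 Y) M.1 T.1 := by
        rw [hM]; exact F.meet_le_left _ _
      have hMI : F.Rel (𝟙 Y) M.1 (F.Im f) := by
        rw [hM, ← hI]; exact F.meet_le_right _ _
      apply Subtype.ext
      apply F.rel_antisymm
      · rw [hU]
        refine app_le F κ M.2 ?_
        rw [hM, hI, hS]
        exact F.le_meet (F.dimg_le (F.iimg_rel _ _)) (dimg_le_im F f _)
      · rw [← h2 f M.1 M.2 hMI, hU, hS]
        refine κ.mono (F.dimg_le (le_rel F.toForm (F.le_iimg ?_) (F.rel_dimg _ _)))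
        exact rel_le F.toForm (F.iimg_rel _ _) hMT

lemma n1'
    (hclos : ∀ {X : C} (A : F.Cl X), F.le A (κ.app A))
    (hidem : ∀ {X : C} (A : F.Cl X), κ.app (κ.app A) = κ.app A)
    (hconorm : @OpConormal _ _ F F κ)
    (hnorm : @OpNormal _ _ F F κ)
    (hN : F.N1) : (F.toForm.fixedSubform κ).N1 ↔
      ∀ {X Y : C} (f : X ⟶ Y) (S : F.Cl X), κ.app S = S → F.le (F.Ker f) S →
        κ.app (F.dimg f S) = F.dimg f S := by
  rw [n1 F κ hclos hidem hconorm hnorm]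
  constructor
  · rintro ⟨h1, -⟩ X Y f S hS hle
    have e := (hN f).2 (κ.app (F.dimg f S))
    rw [h1 f S hS hle] at e
    have hle' : F.Rel (𝟙 Y) (κ.app (F.dimg f S)) (F.Im f) :=
      app_le F κ (hconorm f) (dimg_le_im F f S)
    refine F.rel_antisymm ?_ (hclos _)
    conv => rhs; rw [e]
    exact F.le_meet (F.rel_id _) hle'
  · intro h
    constructor
    · intro X Y f S hS hle
      rw [h f S hS hle, (hN f).1 S]
      exact F.rel_antisymm (F.join_le (F.rel_id S) hle) (F.le_join_left _ _)
    · intro X Y f T hT hle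
      rw [(hN f).2 T]
      have hj : F.meet T (F.Im f) = T :=
        F.rel_antisymm (F.meet_le_left _ _) (F.le_meet (F.rel_id T) hle)
      rw [hj, hT]
end

end ClosedSub

/-- Theorem: for an orean form `F` and a binormal idempotent closure operator `κ`:
(i) (N3) for `F` implies (N3) for `F_κ`; (ii) (N2) for `F` iff (N2) for `F_κ`;
(iii) (N1) for `F_κ` holds iff the two stated implications hold in `F`;
(iv) if `F` satisfies (N1), then `F_κ` satisfies (N1) iff direct images of closed
clusters above the kernel are closed. -/
theorem closed_subform_noetherian_axioms {C : Type u} [Category.{v} C]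
    (F : OreanForm C) (κ : Operator F.toForm F.toForm)
    (hclos : ∀ {X : C} (A : F.Cl X), F.le A (κ.app A))
    (hidem : ∀ {X : C} (A : F.Cl X), κ.app (κ.app A) = κ.app A)
    (hconorm : @OpConormal _ _ F F κ) (hnorm : @OpNormal _ _ F F κ) :
    (F.N3 → (F.toForm.fixedSubform κ).N3) ∧
    (F.N2 ↔ (F.toForm.fixedSubform κ).N2) ∧
    ((F.toForm.fixedSubform κ).N1 ↔
      ((∀ {X Y : C} (f : X ⟶ Y) (S : F.Cl X), κ.app S = S → F.le (F.Ker f) S →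
          F.iimg f (κ.app (F.dimg f S)) = S) ∧
        (∀ {X Y : C} (f : X ⟶ Y) (T : F.Cl Y), κ.app T = T → F.le T (F.Im f) →
          κ.app (F.dimg f (F.iimg f T)) = T))) ∧
    (F.N1 → ((F.toForm.fixedSubform κ).N1 ↔
      ∀ {X Y : C} (f : X ⟶ Y) (S : F.Cl X), κ.app S = S → F.le (F.Ker f) S →
        κ.app (F.dimg f S) = F.dimg f S)) :=
  ⟨ClosedSub.n3 F κ hclos hidem hconorm hnorm, ClosedSub.n2 F κ hclos hidem hconorm hnorm,
    ClosedSub.n1 F κ hclos hidem hconorm hnorm, ClosedSub.n1' F κ hclos hidem hconorm hnorm⟩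
end
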